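/- No CMDRR(4,2) exists. -/

import Mathlib

open scoped Classical

/-- A mixed doubles game: an unordered pair of teams, each team being a
(man, woman) pair, for `n` men and `n` women indexed by `Fin n`. -/
abbrev Game (n : ℕ) := Sym2 (Fin n × Fin n)

/-- A game is valid if its two teams have distinct men and distinct women. -/
def Game.valid {n : ℕ} (g : Game n) : Prop :=
  ∃ a b : Fin n × Fin n, g = s(a, b) ∧ a.1 ≠ b.1 ∧ a.2 ≠ b.2

/-- Man `m` plays in game `g`. -/
def Game.manIn {n : ℕ} (m : Fin n) (g : Game n) : Prop :=
  ∃ a b : Fin n × Fin n, g = s(a, b) ∧ a.1 = m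

/-- Woman `w` plays in game `g`. -/
def Game.womanIn {n : ℕ} (w : Fin n) (g : Game n) : Prop :=
  ∃ a b : Fin n × Fin n, g = s(a, b) ∧ a.2 = w

/-- Man `m` and woman `w` are partners (teammates) in game `g`. -/
def Game.partners {n : ℕ} (m w : Fin n) (g : Game n) : Prop :=
  (m, w) ∈ g

/-- Man `m` and woman `w` are opponents in game `g` (on different teams). -/
def Game.opposesMW {n : ℕ} (m w : Fin n) (g : Game n) : Prop :=
  ∃ a b : Fin n × Fin n, g = s(a, b) ∧ a.1 = m ∧ b.2 = w

/-- Men `m` and `m'` are opponents in game `g`. -/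
def Game.opposesMM {n : ℕ} (m m' : Fin n) (g : Game n) : Prop :=
  ∃ a b : Fin n × Fin n, g = s(a, b) ∧ a.1 = m ∧ b.1 = m'

/-- Women `w` and `w'` are opponents in game `g`. -/
def Game.opposesWW {n : ℕ} (w w' : Fin n) (g : Game n) : Prop :=
  ∃ a b : Fin n × Fin n, g = s(a, b) ∧ a.2 = w ∧ b.2 = w'

/-- A complete mixed doubles round robin tournament CMDRR(n,k). -/
structure CMDRR (n k : ℕ) where
  /-- The spouse pairs (man, woman). -/
  spouses : Finset (Fin n × Fin n)
  spouses_card : spouses.card = k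
  spouses_inj1 : ∀ p ∈ spouses, ∀ q ∈ spouses, p.1 = q.1 → p = q
  spouses_inj2 : ∀ p ∈ spouses, ∀ q ∈ spouses, p.2 = q.2 → p = q
  /-- The multiset of games. -/
  games : Multiset (Game n)
  valid : ∀ g ∈ games, g.valid
  /-- (i) no game contains both members of a spouse pair. -/
  no_spouse_game : ∀ g ∈ games, ∀ p ∈ spouses, ¬ (Game.manIn p.1 g ∧ Game.womanIn p.2 g)
  /-- (ii) every non-spouse man-woman pair partners exactly once ... -/
  partners_once : ∀ m w : Fin n, (m, w) ∉ spouses →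
    games.countP (Game.partners m w) = 1
  /-- ... and opposes exactly once. -/
  opposesMW_once : ∀ m w : Fin n, (m, w) ∉ spouses →
    games.countP (Game.opposesMW m w) = 1
  /-- (iii) a spoused man opposes every other man exactly once. -/
  spousedM_opposes : ∀ m ∈ spouses.image Prod.fst, ∀ m' : Fin n, m' ≠ m →
    games.countP (Game.opposesMM m m') = 1
  /-- (iii) a spoused woman opposes every other woman exactly once. -/
  spousedW_opposes : ∀ w ∈ spouses.image Prod.snd, ∀ w' : Fin n, w' ≠ w →
    games.countP (Game.opposesWW w w') = 1
  /-- (iv) an unspoused man opposes exactly one other unspoused man exactly twice,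
  and all other men exactly once. -/
  unspousedM_opposes : ∀ m : Fin n, m ∉ spouses.image Prod.fst →
    ∃ m' : Fin n, m' ≠ m ∧ m' ∉ spouses.image Prod.fst ∧
      games.countP (Game.opposesMM m m') = 2 ∧
      ∀ m'' : Fin n, m'' ≠ m → m'' ≠ m' → games.countP (Game.opposesMM m m'') = 1
  /-- (iv) likewise for unspoused women. -/
  unspousedW_opposes : ∀ w : Fin n, w ∉ spouses.image Prod.snd →
    ∃ w' : Fin n, w' ≠ w ∧ w' ∉ spouses.image Prod.snd ∧
      games.countP (Game.opposesWW w w') = 2 ∧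
      ∀ w'' : Fin n, w'' ≠ w → w'' ≠ w' → games.countP (Game.opposesWW w w'') = 1

/-- A round: a multiset of games in which each player appears at most once. -/
def IsRound {n : ℕ} (r : Multiset (Game n)) : Prop :=
  (∀ m : Fin n, r.countP (Game.manIn m) ≤ 1) ∧
  (∀ w : Fin n, r.countP (Game.womanIn w) ≤ 1)

/-- A full round: all players play if `n` is even; all but exactly one man and
one woman play if `n` is odd. -/
def FullRound {n : ℕ} (r : Multiset (Game n)) : Prop :=
  IsRound r ∧
  ((Even n ∧ (∀ m : Fin n, r.countP (Game.manIn m) = 1) ∧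
      (∀ w : Fin n, r.countP (Game.womanIn w) = 1)) ∨
   (¬ Even n ∧ (∃! m : Fin n, r.countP (Game.manIn m) = 0) ∧
      (∃! w : Fin n, r.countP (Game.womanIn w) = 0)))


theorem countP_one_uniq {α : Type*} {s : Multiset α} {p : α → Prop}
    (h : s.countP p = 1) {g g' : α} (hg : g ∈ s) (hg' : g' ∈ s) (pg : p g) (pg' : p g') :
    g = g' := by
  rw [Multiset.countP_eq_card_filter, Multiset.card_eq_one] at h
  obtain ⟨a, ha⟩ := h
  have h1 : g ∈ s.filter p := Multiset.mem_filter.2 ⟨hg, pg⟩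
  have h2 : g' ∈ s.filter p := Multiset.mem_filter.2 ⟨hg', pg'⟩
  rw [ha, Multiset.mem_singleton] at h1 h2
  rw [h1, h2]

theorem countP_one_ex {α : Type*} {s : Multiset α} {p : α → Prop}
    (h : s.countP p = 1) : ∃ g ∈ s, p g := by
  apply Multiset.countP_pos.1
  omega

/-- Abstract combinatorial core. -/
theorem core {M W : Type*} (P : M → W → M → W → Prop) (a b c d : M) (A B C D : W)
    (hM : ∀ x, x = a ∨ x = b ∨ x = c ∨ x = d) (hW : ∀ x, x = A ∨ x = B ∨ x = C ∨ x = D)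
    (hab : a ≠ b) (hac : a ≠ c) (had : a ≠ d) (hbc : b ≠ c) (hbd : b ≠ d) (hcd : c ≠ d)
    (hAB : A ≠ B) (hAC : A ≠ C) (hAD : A ≠ D) (hBC : B ≠ C) (hBD : B ≠ D) (hCD : C ≠ D)
    (symm : ∀ x X y Y, P x X y Y → P y Y x X)
    (v1 : ∀ x X y Y, P x X y Y → x ≠ y) (v2 : ∀ x X y Y, P x X y Y → X ≠ Y)
    (sa1 : ∀ y Y, ¬ P a A y Y) (sa2 : ∀ X y, ¬ P a X y A)
    (sb1 : ∀ y Y, ¬ P b B y Y) (sb2 : ∀ X y, ¬ P b X y B)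
    (pe : ∀ x X, ¬ (x = a ∧ X = A) → ¬ (x = b ∧ X = B) → ∃ y Y, P x X y Y)
    (pu : ∀ x X y Y y' Y', P x X y Y → P x X y' Y' → y = y' ∧ Y = Y')
    (ou : ∀ x Y X y X' y', P x X y Y → P x X' y' Y → y = y' ∧ X = X')
    (mu : ∀ x y X Y X' Y', x = a ∨ x = b → P x X y Y → P x X' y Y' → X = X' ∧ Y = Y')
    (we : ∃ x y, P x A y B)
    (wu : ∀ X Y x y x' y', X = A ∨ X = B → P x X y Y → P x' X y' Y → x = x' ∧ y = y')
    (g0 : P a C b D) (g1 : P a B c C) : False := by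
  have g2 : P a D d B := by
    obtain ⟨y, Y, h⟩ := pe a D (by grind) (by grind)
    have := hM y; have := hW Y; have := symm _ _ _ _ h
    grind
  have g3 : P d A c B := by
    obtain ⟨x, y, h⟩ := we
    have := hM x; have := hM y; have := symm _ _ _ _ h; have := symm _ _ _ _ g2
    grind
  have g0' := symm _ _ _ _ g0
  have g1' := symm _ _ _ _ g1
  have g2' := symm _ _ _ _ g2
  have g3' := symm _ _ _ _ g3
  have g4 : ∃ u, P b A u D := by
    obtain ⟨y, Y, h⟩ := pe b A (by grind) (by grind)
    have := hW Y
    have := symm _ _ _ _ h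
    grind
  obtain ⟨u, g4⟩ := g4
  have g4' := symm _ _ _ _ g4
  have g5 : ∃ v, P b C v A := by
    obtain ⟨y, Y, h⟩ := pe b C (by grind) (by grind)
    have := hW Y
    have := symm _ _ _ _ h
    grind
  obtain ⟨v, g5⟩ := g5
  have g5' := symm _ _ _ _ g5
  have g6 : P d C c D := by
    obtain ⟨y, Y, h⟩ := pe d C (by grind) (by grind)
    have := hM y; have := hW Y; have := symm _ _ _ _ h
    grind
  have g6' := symm _ _ _ _ g6
  have hu : u = d := by
    have := hM u
    grind
  have hv : v = c := by
    have := hM v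
    grind
  subst hu hv
  grind

theorem others (a b : Fin 4) (h : a ≠ b) : ∃ c d, a ≠ c ∧ a ≠ d ∧ b ≠ c ∧ b ≠ d ∧ c ≠ d ∧
    ∀ x, x = a ∨ x = b ∨ x = c ∨ x = d := by
  revert a b; decide

/-- No CMDRR(4,2) exists. -/
theorem no_cmdrr_4_2 : IsEmpty (CMDRR 4 2) := by
  refine ⟨fun T => ?_⟩
  obtain ⟨⟨a, A⟩, ⟨b, B⟩, hne, hS⟩ := Finset.card_eq_two.1 T.spouses_card
  have hmem : ∀ p, p ∈ T.spouses ↔ p = (a, A) ∨ p = (b, B) := by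
    intro p; rw [hS]; simp
  have hab : a ≠ b := fun h => hne (T.spouses_inj1 _ ((hmem _).2 (Or.inl rfl)) _
    ((hmem _).2 (Or.inr rfl)) h)
  have hAB : A ≠ B := fun h => hne (T.spouses_inj2 _ ((hmem _).2 (Or.inl rfl)) _
    ((hmem _).2 (Or.inr rfl)) h)
  obtain ⟨c, d, hac, had, hbc, hbd, hcd, hM⟩ := others a b hab
  obtain ⟨C, D, hAC, hAD, hBC, hBD, hCD, hW⟩ := others A B hAB
  let P : Fin 4 → Fin 4 → Fin 4 → Fin 4 → Prop := fun x X y Y =>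
    (s((x, X), (y, Y)) : Game 4) ∈ T.games
  have symm : ∀ x X y Y, P x X y Y → P y Y x X := by
    intro x X y Y h
    simp only [P] at h ⊢
    rwa [Sym2.eq_swap]
  have v12 : ∀ x X y Y, P x X y Y → x ≠ y ∧ X ≠ Y := by
    intro x X y Y h
    obtain ⟨⟨p, p'⟩, ⟨q, q'⟩, he, h1, h2⟩ := T.valid _ h
    simp only [Sym2.eq_iff, Prod.mk.injEq] at he
    grind
  have ns : ∀ x X y Y, P x X y Y → ∀ m w, (m, w) ∈ T.spouses → (x = m ∨ y = m) →
      (X = w ∨ Y = w) → False := by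
    intro x X y Y h m w hs hm hw
    refine T.no_spouse_game _ h _ hs ⟨?_, ?_⟩
    · rcases hm with rfl | rfl
      · exact ⟨_, _, rfl, rfl⟩
      · exact ⟨_, _, Sym2.eq_swap, rfl⟩
    · rcases hw with rfl | rfl
      · exact ⟨_, _, rfl, rfl⟩
      · exact ⟨_, _, Sym2.eq_swap, rfl⟩
  have sA : (a, A) ∈ T.spouses := (hmem _).2 (Or.inl rfl)
  have sB : (b, B) ∈ T.spouses := (hmem _).2 (Or.inr rfl)
  have sm : ∀ x, x = a ∨ x = b → x ∈ T.spouses.image Prod.fst := by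
    rintro x (rfl | rfl)
    · exact Finset.mem_image.2 ⟨_, sA, rfl⟩
    · exact Finset.mem_image.2 ⟨_, sB, rfl⟩
  have sw : ∀ x, x = A ∨ x = B → x ∈ T.spouses.image Prod.snd := by
    rintro x (rfl | rfl)
    · exact Finset.mem_image.2 ⟨_, sA, rfl⟩
    · exact Finset.mem_image.2 ⟨_, sB, rfl⟩
  have pe : ∀ x X, ¬ (x = a ∧ X = A) → ¬ (x = b ∧ X = B) → ∃ y Y, P x X y Y := by
    intro x X h1 h2
    have hn : (x, X) ∉ T.spouses := by
      rw [hmem]; simp only [Prod.mk.injEq]; tauto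
    obtain ⟨g, hg, hp⟩ := countP_one_ex (T.partners_once x X hn)
    obtain ⟨⟨y, Y⟩, rfl⟩ := hp
    exact ⟨y, Y, hg⟩
  have nsp : ∀ x X y Y, P x X y Y → (x, X) ∉ T.spouses := fun x X y Y h hs =>
    ns _ _ _ _ h _ _ hs (Or.inl rfl) (Or.inl rfl)
  have nso : ∀ x X y Y, P x X y Y → (x, Y) ∉ T.spouses := fun x X y Y h hs =>
    ns _ _ _ _ h _ _ hs (Or.inl rfl) (Or.inr rfl)
  have pu : ∀ x X y Y y' Y', P x X y Y → P x X y' Y' → y = y' ∧ Y = Y' := by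
    intro x X y Y y' Y' h h'
    have := countP_one_uniq (T.partners_once x X (nsp _ _ _ _ h)) h h'
      (Sym2.mem_mk_left _ _) (Sym2.mem_mk_left _ _)
    simp only [Sym2.eq_iff, Prod.mk.injEq] at this
    grind
  have ou : ∀ x Y X y X' y', P x X y Y → P x X' y' Y → y = y' ∧ X = X' := by
    intro x Y X y X' y' h h'
    have := countP_one_uniq (T.opposesMW_once x Y (nso _ _ _ _ h)) h h'
      ⟨_, _, rfl, rfl, rfl⟩ ⟨_, _, rfl, rfl, rfl⟩
    simp only [Sym2.eq_iff, Prod.mk.injEq] at this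
    have := v12 _ _ _ _ h
    have := v12 _ _ _ _ h'
    grind
  have mu : ∀ x y X Y X' Y', x = a ∨ x = b → P x X y Y → P x X' y Y' → X = X' ∧ Y = Y' := by
    intro x y X Y X' Y' hx h h'
    have hv := v12 _ _ _ _ h
    have := countP_one_uniq (T.spousedM_opposes x (sm x hx) y hv.1.symm) h h'
      ⟨_, _, rfl, rfl, rfl⟩ ⟨_, _, rfl, rfl, rfl⟩
    simp only [Sym2.eq_iff, Prod.mk.injEq] at this
    grind
  have wu : ∀ X Y x y x' y', X = A ∨ X = B → P x X y Y → P x' X y' Y → x = x' ∧ y = y' := by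
    intro X Y x y x' y' hx h h'
    have hv := v12 _ _ _ _ h
    have := countP_one_uniq (T.spousedW_opposes X (sw X hx) Y hv.2.symm) h h'
      ⟨_, _, rfl, rfl, rfl⟩ ⟨_, _, rfl, rfl, rfl⟩
    simp only [Sym2.eq_iff, Prod.mk.injEq] at this
    grind
  have we : ∃ x y, P x A y B := by
    obtain ⟨g, hg, ⟨x, X⟩, ⟨y, Y⟩, rfl, h1, h2⟩ :=
      countP_one_ex (T.spousedW_opposes A (sw A (Or.inl rfl)) B hAB.symm)
    simp only at h1 h2
    subst h1 h2
    exact ⟨x, y, hg⟩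
  have me : ∃ X Y, P a X b Y := by
    obtain ⟨g, hg, ⟨x, X⟩, ⟨y, Y⟩, rfl, h1, h2⟩ :=
      countP_one_ex (T.spousedM_opposes a (sm a (Or.inl rfl)) b hab.symm)
    simp only at h1 h2
    subst h1 h2
    exact ⟨X, Y, hg⟩
  have v1 : ∀ x X y Y, P x X y Y → x ≠ y := fun x X y Y h => (v12 x X y Y h).1
  have v2 : ∀ x X y Y, P x X y Y → X ≠ Y := fun x X y Y h => (v12 x X y Y h).2
  have sa1 : ∀ y Y, ¬ P a A y Y := fun y Y h => nsp _ _ _ _ h sA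
  have sa2 : ∀ X y, ¬ P a X y A := fun y Y h => nso _ _ _ _ h sA
  have sb1 : ∀ y Y, ¬ P b B y Y := fun y Y h => nsp _ _ _ _ h sB
  have sb2 : ∀ X y, ¬ P b X y B := fun y Y h => nso _ _ _ _ h sB
  clear_value P
  have key : ∀ C D, A ≠ C → A ≠ D → B ≠ C → B ≠ D → C ≠ D →
      (∀ x, x = A ∨ x = B ∨ x = C ∨ x = D) → P a C b D → False := by
    intro C D hAC hAD hBC hBD hCD hW g0
    have g1 : P a B c C ∨ P a B d C := by
      obtain ⟨y, Y, h⟩ := pe a B (by grind) (by grind)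
      have := hM y; have := hW Y; have := symm _ _ _ _ h
      grind
    rcases g1 with g1 | g1
    · exact core P a b c d A B C D hM hW hab hac had hbc hbd hcd hAB hAC hAD hBC hBD hCD
        symm v1 v2 sa1 sa2 sb1 sb2 pe pu ou mu we wu g0 g1
    · exact core P a b d c A B C D (fun x => by have := hM x; tauto) hW hab had hac hbd hbc
        hcd.symm hAB hAC hAD hBC hBD hCD
        symm v1 v2 sa1 sa2 sb1 sb2 pe pu ou mu we wu g0 g1
  obtain ⟨X, Y, h⟩ := me
  have h' := symm _ _ _ _ h
  have hXY : (X = C ∧ Y = D) ∨ (X = D ∧ Y = C) := by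
    have := hW X; have := hW Y
    grind
  rcases hXY with ⟨rfl, rfl⟩ | ⟨rfl, rfl⟩
  · exact key _ _ hAC hAD hBC hBD hCD hW h
  · exact key _ _ hAD hAC hBD hBC hCD.symm (fun x => by have := hW x; tauto) h
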